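/- Let G be the 5-vertex graph consisting of two triangles sharing a single common vertex, and let H be the 5-vertex graph obtained from the 4-cycle with one diagonal by attaching a pendant vertex to a degree-3 vertex. Then the chromatic symmetric functions agree, X_G = X_H, but the Kromatic symmetric functions differ, \overline{X}_G ≠ \overline{X}_H. In particular, \overline{X}_H has a nonzero coefficient on \overline{\widetilde{m}}_{(2,2,2)} in its K-theoretic augmented monomial expansion while \overline{X}_G does not (every stable set of G containing the shared vertex has size 1, so every stable set cover of G contains a singleton). -/

import Mathlib

open scoped Classical

noncomputable section

/-- A proper set coloring assigns to each vertex a nonempty finite set of colors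
(positive integers, here indexed by `ℕ`) such that adjacent vertices get disjoint sets. -/
def IsProperSetColoring {V : Type*} (G : SimpleGraph V) (κ : V → Finset ℕ) : Prop :=
  (∀ v, (κ v).Nonempty) ∧ ∀ ⦃u v : V⦄, G.Adj u v → Disjoint (κ u) (κ v)

/-- The exponent vector of the monomial `∏_v (∏_{i ∈ κ v} x_i)^(ω v)`. -/
def setColWeight {V : Type*} [Fintype V] (ω : V → ℕ) (κ : V → Finset ℕ) : ℕ →₀ ℕ :=
  ∑ v : V, ω v • (κ v).sum (fun i => Finsupp.single i 1)

/-- The (vertex-weighted) Kromatic symmetric function, as a power series in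
`x_0, x_1, x_2, …`: the coefficient of a monomial is the number of proper set
colorings producing that monomial. -/
def kromatic {V : Type*} [Fintype V] (G : SimpleGraph V) (ω : V → ℕ) :
    MvPowerSeries ℕ ℤ :=
  fun d => (Nat.card {κ : V → Finset ℕ //
    IsProperSetColoring G κ ∧ setColWeight ω κ = d} : ℤ)

def IsProperColoring {V : Type*} (G : SimpleGraph V) (κ : V → ℕ) : Prop :=
  ∀ ⦃u v : V⦄, G.Adj u v → κ u ≠ κ v

def colWeight {V : Type*} [Fintype V] (κ : V → ℕ) : ℕ →₀ ℕ :=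
  ∑ v : V, Finsupp.single (κ v) 1

/-- The chromatic symmetric function. -/
def chromatic {V : Type*} [Fintype V] (G : SimpleGraph V) : MvPowerSeries ℕ ℤ :=
  fun d => (Nat.card {κ : V → ℕ // IsProperColoring G κ ∧ colWeight κ = d} : ℤ)

/-- A stable set cover: a collection of distinct nonempty stable sets whose union is
the whole vertex set. -/
def IsStableSetCover {V : Type*} (G : SimpleGraph V) (C : Finset (Finset V)) : Prop :=
  (∀ S ∈ C, S.Nonempty ∧ ∀ a ∈ S, ∀ b ∈ S, ¬ G.Adj a b) ∧
  ∀ v : V, ∃ S ∈ C, v ∈ S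

/-- Two triangles sharing a common vertex (vertices `1,…,5` are `0,…,4` here):
edges `{1,3},{1,4},{3,4},{2,3},{2,5},{3,5}`. -/
def Gex : SimpleGraph (Fin 5) :=
  SimpleGraph.fromRel (fun a b =>
    (a = 0 ∧ b = 2) ∨ (a = 0 ∧ b = 3) ∨ (a = 2 ∧ b = 3) ∨
    (a = 1 ∧ b = 2) ∨ (a = 1 ∧ b = 4) ∨ (a = 2 ∧ b = 4))

/-- The 4-cycle with one diagonal, with a pendant vertex attached:
edges `{1,2},{1,4},{2,3},{2,4},{3,4},{3,5}`. -/
def Hex : SimpleGraph (Fin 5) :=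
  SimpleGraph.fromRel (fun a b =>
    (a = 0 ∧ b = 1) ∨ (a = 0 ∧ b = 3) ∨ (a = 1 ∧ b = 2) ∨
    (a = 1 ∧ b = 3) ∨ (a = 2 ∧ b = 3) ∨ (a = 2 ∧ b = 4))

theorem isProperColoring_Gex {κ : Fin 5 → ℕ} :
    IsProperColoring Gex κ ↔
      κ 0 ≠ κ 2 ∧ κ 0 ≠ κ 3 ∧ κ 2 ≠ κ 3 ∧ κ 1 ≠ κ 2 ∧ κ 1 ≠ κ 4 ∧ κ 2 ≠ κ 4 := by
  constructor
  · intro h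
    refine ⟨h ?_, h ?_, h ?_, h ?_, h ?_, h ?_⟩ <;> simp [Gex]
  · rintro ⟨h1, h2, h3, h4, h5, h6⟩ u v huv
    rw [Gex, SimpleGraph.fromRel_adj] at huv
    grind (splits := 20)

theorem isProperColoring_Hex {κ : Fin 5 → ℕ} :
    IsProperColoring Hex κ ↔
      κ 0 ≠ κ 1 ∧ κ 0 ≠ κ 3 ∧ κ 1 ≠ κ 2 ∧ κ 1 ≠ κ 3 ∧ κ 2 ≠ κ 3 ∧ κ 2 ≠ κ 4 := by
  constructor
  · intro h
    refine ⟨h ?_, h ?_, h ?_, h ?_, h ?_, h ?_⟩ <;> simp [Hex]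
  · rintro ⟨h1, h2, h3, h4, h5, h6⟩ u v huv
    rw [Hex, SimpleGraph.fromRel_adj] at huv
    grind (splits := 20)

/-- Turns proper colorings of `Gex` into proper colorings of `Hex` by permuting the
colors of the vertices, in a way that depends on whether vertices `1` and `3` agree. -/
def toHex (κ : Fin 5 → ℕ) : Fin 5 → ℕ :=
  if κ 1 = κ 3 then ![κ 4, κ 3, κ 0, κ 2, κ 1] else ![κ 4, κ 2, κ 3, κ 1, κ 0]

/-- The inverse of `toHex` on proper colorings. -/
def toGex (κ : Fin 5 → ℕ) : Fin 5 → ℕ :=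
  if κ 1 = κ 4 then ![κ 2, κ 4, κ 3, κ 1, κ 0] else ![κ 4, κ 3, κ 1, κ 2, κ 0]

theorem colWeight_toHex (κ : Fin 5 → ℕ) : colWeight (toHex κ) = colWeight κ := by
  unfold toHex colWeight
  split_ifs <;> simp [Fin.sum_univ_five] <;> abel

theorem colWeight_toGex (κ : Fin 5 → ℕ) : colWeight (toGex κ) = colWeight κ := by
  unfold toGex colWeight
  split_ifs <;> simp [Fin.sum_univ_five] <;> abel

theorem IsProperColoring.toHex {κ : Fin 5 → ℕ} (h : IsProperColoring Gex κ) :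
    IsProperColoring Hex (toHex κ) := by
  rw [isProperColoring_Gex] at h
  rw [isProperColoring_Hex, _root_.toHex]
  split_ifs <;> simp <;> grind

theorem IsProperColoring.toGex {κ : Fin 5 → ℕ} (h : IsProperColoring Hex κ) :
    IsProperColoring Gex (toGex κ) := by
  rw [isProperColoring_Hex] at h
  rw [isProperColoring_Gex, _root_.toGex]
  split_ifs <;> simp <;> grind

theorem toGex_toHex {κ : Fin 5 → ℕ} (h : IsProperColoring Gex κ) :
    toGex (toHex κ) = κ := by
  rw [isProperColoring_Gex] at h
  unfold toGex toHex
  ext v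
  fin_cases v <;> split_ifs <;> simp_all

theorem toHex_toGex {κ : Fin 5 → ℕ} (h : IsProperColoring Hex κ) :
    toHex (toGex κ) = κ := by
  rw [isProperColoring_Hex] at h
  unfold toGex toHex
  ext v
  fin_cases v <;> split_ifs <;> simp_all

theorem chromatic_Gex_eq_chromatic_Hex : chromatic Gex = chromatic Hex := by
  funext d
  unfold chromatic
  congr 1
  exact Nat.card_congr
    { toFun := fun κ => ⟨toHex κ, κ.2.1.toHex, (colWeight_toHex _).trans κ.2.2⟩
      invFun := fun κ => ⟨toGex κ, κ.2.1.toGex, (colWeight_toGex _).trans κ.2.2⟩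
      left_inv := fun κ => Subtype.ext (toGex_toHex κ.2.1)
      right_inv := fun κ => Subtype.ext (toHex_toGex κ.2.1) }

theorem setColWeight_apply {V : Type*} [Fintype V] (ω : V → ℕ) (κ : V → Finset ℕ) (i : ℕ) :
    setColWeight ω κ i = ∑ v, if i ∈ κ v then ω v else 0 := by
  simp [setColWeight, Finsupp.finsetSum_apply, Finsupp.single_apply]

theorem finite_setColWeight_eq {V : Type*} [Fintype V] {ω : V → ℕ} (hω : ∀ v, ω v ≠ 0)
    (d : ℕ →₀ ℕ) : {κ : V → Finset ℕ | setColWeight ω κ = d}.Finite := by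
  refine (Set.Finite.pi' fun _ : V => d.support.powerset.finite_toSet).subset ?_
  rintro κ rfl v
  simp only [Finset.coe_powerset, Set.mem_preimage, Set.mem_powerset_iff, Finset.coe_subset]
  intro i hi
  rw [Finsupp.mem_support_iff, setColWeight_apply, Ne, Finset.sum_eq_zero_iff]
  exact fun h => hω v (by simpa [hi] using h v (Finset.mem_univ v))

/-- A proper set coloring of `Hex` using each of the colors `0, 1, 2` exactly twice. -/
def hexSetColoring : Fin 5 → Finset ℕ := ![{0}, {1}, {0}, {2}, {1, 2}]

theorem isProperSetColoring_hexSetColoring : IsProperSetColoring Hex hexSetColoring := by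
  constructor
  · intro v
    fin_cases v <;> simp [hexSetColoring]
  · intro u v huv
    rw [Hex, SimpleGraph.fromRel_adj] at huv
    rcases huv with ⟨-, (h | h | h | h | h | h) | (h | h | h | h | h | h)⟩ <;>
      obtain ⟨rfl, rfl⟩ := h <;> simp [hexSetColoring]

theorem setColWeight_hexSetColoring_ne_one (i : ℕ) :
    setColWeight (fun _ => 1) hexSetColoring i ≠ 1 := by
  rw [setColWeight_apply, Fin.sum_univ_five]
  simp only [hexSetColoring]
  simp
  grind

theorem IsProperSetColoring.exists_setColWeight_eq_one {κ : Fin 5 → Finset ℕ}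
    (h : IsProperSetColoring Gex κ) : ∃ i, setColWeight (fun _ => 1) κ i = 1 := by
  obtain ⟨i, hi⟩ := h.1 2
  refine ⟨i, ?_⟩
  rw [setColWeight_apply, Finset.sum_eq_single 2]
  · simp [hi]
  · intro v _ hv
    have hadj : Gex.Adj 2 v := by
      fin_cases v <;> simp_all [Gex]
    simp [Finset.disjoint_left.1 (h.2 hadj) hi]
  · simp

theorem kromatic_Gex_ne_kromatic_Hex :
    kromatic Gex (fun _ => 1) ≠ kromatic Hex (fun _ => 1) := by
  intro h
  have hd := congrFun h (setColWeight (fun _ => 1) hexSetColoring)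
  simp only [kromatic, Nat.cast_inj] at hd
  have hG : IsEmpty {κ : Fin 5 → Finset ℕ // IsProperSetColoring Gex κ ∧
      setColWeight (fun _ => 1) κ = setColWeight (fun _ => 1) hexSetColoring} := by
    refine ⟨fun κ => ?_⟩
    obtain ⟨i, hi⟩ := κ.2.1.exists_setColWeight_eq_one
    exact setColWeight_hexSetColoring_ne_one i (κ.2.2 ▸ hi)
  have hH : Finite {κ : Fin 5 → Finset ℕ // IsProperSetColoring Hex κ ∧
      setColWeight (fun _ => 1) κ = setColWeight (fun _ => 1) hexSetColoring} :=
    ((finite_setColWeight_eq (fun _ => one_ne_zero) _).subset fun _ hκ => hκ.2).to_subtype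
  rw [Nat.card_of_isEmpty] at hd
  rcases Nat.card_eq_zero.1 hd.symm with hE | hI
  · exact hE.false ⟨hexSetColoring, isProperSetColoring_hexSetColoring, rfl⟩
  · exact hI.not_finite hH

theorem exists_isStableSetCover_Hex : ∃ C : Finset (Finset (Fin 5)), IsStableSetCover Hex C ∧
    C.val.map Finset.card = ({2, 2, 2} : Multiset ℕ) := by
  have h1 : ({0, 2} : Finset (Fin 5)) ∉ ({{1, 4}, {3, 4}} : Finset (Finset (Fin 5))) := by
    simp [Finset.ext_iff, Fin.forall_fin_succ]
  have h2 : ({1, 4} : Finset (Fin 5)) ∉ ({{3, 4}} : Finset (Finset (Fin 5))) := by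
    simp [Finset.ext_iff, Fin.forall_fin_succ]
  refine ⟨{{0, 2}, {1, 4}, {3, 4}}, ⟨?_, ?_⟩, ?_⟩
  · simp [Hex]
  · intro v
    fin_cases v <;> simp
  · rw [Finset.insert_val_of_notMem h1, Finset.insert_val_of_notMem h2]
    simp

theorem not_exists_isStableSetCover_Gex : ¬ ∃ C : Finset (Finset (Fin 5)),
    IsStableSetCover Gex C ∧ C.val.map Finset.card = ({2, 2, 2} : Multiset ℕ) := by
  rintro ⟨C, ⟨hstable, hcover⟩, hcard⟩
  obtain ⟨S, hS, h2S⟩ := hcover 2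
  have hScard : S.card = 2 := by
    have : S.card ∈ C.val.map Finset.card := Multiset.mem_map_of_mem _ hS
    simpa [hcard] using this
  obtain ⟨v, hvS, hv⟩ := Finset.exists_mem_ne (by omega : 1 < S.card) 2
  refine (hstable S hS).2 2 h2S v hvS ?_
  fin_cases v <;> simp_all [Gex]

/-- `G` and `H` have equal chromatic symmetric functions but different Kromatic
symmetric functions: in the K-theoretic augmented monomial expansion (indexed by
stable set covers), `X̄_H` has a nonzero coefficient on `m̄~_{(2,2,2)}` (there is a
stable set cover of `H` by three 2-element stable sets) while `X̄_G` does not (there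
is no such cover of `G`). -/
theorem kromatic_distinguishes_Gex_Hex :
    chromatic Gex = chromatic Hex ∧
    kromatic Gex (fun _ => 1) ≠ kromatic Hex (fun _ => 1) ∧
    (∃ C : Finset (Finset (Fin 5)), IsStableSetCover Hex C ∧
      C.val.map Finset.card = ({2, 2, 2} : Multiset ℕ)) ∧
    (¬ ∃ C : Finset (Finset (Fin 5)), IsStableSetCover Gex C ∧
      C.val.map Finset.card = ({2, 2, 2} : Multiset ℕ)) := by
  exact ⟨chromatic_Gex_eq_chromatic_Hex, kromatic_Gex_ne_kromatic_Hex,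
    exists_isStableSetCover_Hex, not_exists_isStableSetCover_Gex⟩
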